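/- arXiv:2004.14741 — 2 statements merged into one kernel-verified Lean document; each statement's English description precedes it below -/
import Mathlib

section
/- For every n ≥ 2, every k ≥ 3, and every δ ∈ (0,1), the worst-case Lipschitz constant of δ-perturbed n-player k-action anonymous games satisfies λ(n,k,δ) = (1-δ)·P(S_{n-2}^{2δ/k} ∈ {0,1}), where (S_m^r) is the lazy symmetric random walk on ℤ with rate r. -/
open Finset

/-- `perturbW k δ a j` is the probability that the `δ`-perturbation of the pure
action `a ∈ [k]` plays the action `j`: with probability `1-δ` play `a`, with
probability `δ` play uniformly in `[k]`. -/
noncomputable def perturbW (k : ℕ) (δ : ℝ) (a j : Fin k) : ℝ :=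
  (1 - δ) * (if j = a then 1 else 0) + δ / k

/-- Probability that the (independent) `δ`-perturbation of the pure profile `a`
realises as the pure profile `b`. -/
noncomputable def profW (n k : ℕ) (δ : ℝ) (a b : Fin n → Fin k) : ℝ :=
  ∏ i, perturbW k δ (a i) (b i)

/-- A game: payoffs lie in `[0,1]`. -/
def IsGame (n k : ℕ) (g : (Fin n → Fin k) → Fin n → ℝ) : Prop :=
  ∀ a i, g a i ∈ Set.Icc (0 : ℝ) 1

/-- The number of players taking action `j` in the profile `a`. -/
def actCount (n k : ℕ) (a : Fin n → Fin k) (j : Fin k) : ℕ :=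
  (Finset.univ.filter fun i => a i = j).card

/-- A game is anonymous if each player's payoff depends only on his own action and
on the number of players taking each action. -/
def IsAnonymous (n k : ℕ) (g : (Fin n → Fin k) → Fin n → ℝ) : Prop :=
  ∀ (a b : Fin n → Fin k) (i : Fin n), a i = b i →
    (∀ j, actCount n k a j = actCount n k b j) → g a i = g b i

/-- The `δ`-perturbed game `g^δ`. -/
noncomputable def perturbGame (n k : ℕ) (δ : ℝ) (g : (Fin n → Fin k) → Fin n → ℝ) :
    (Fin n → Fin k) → Fin n → ℝ :=
  fun a i => ∑ b : Fin n → Fin k, profW n k δ a b * g b i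

/-- The Lipschitz constant of a game: the largest change of some player's payoff
when a single opponent changes his action. -/
noncomputable def lipC (n k : ℕ) (g : (Fin n → Fin k) → Fin n → ℝ) : ℝ :=
  sSup {x | ∃ (i : Fin n) (a b : Fin n → Fin k), a i = b i ∧
    (Finset.univ.filter fun j => a j ≠ b j).card = 1 ∧ x = |g a i - g b i|}

/-- The worst-case Lipschitz constant of `δ`-perturbed `n`-player `k`-action
anonymous games. -/
noncomputable def lam (n k : ℕ) (δ : ℝ) : ℝ :=
  sSup {x | ∃ g : (Fin n → Fin k) → Fin n → ℝ,
    IsGame n k g ∧ IsAnonymous n k g ∧ x = lipC n k (perturbGame n k δ g)}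
/-- `walk r m z` is the probability that the lazy symmetric random walk on `ℤ` with
rate `r` (i.i.d. increments: `0` w.p. `1-r`, `±1` w.p. `r/2` each), started at `0`,
is at `z` after `m` steps; i.e. `P(S_m^r = z)`. -/
noncomputable def walk (r : ℝ) : ℕ → ℤ → ℝ
  | 0, z => if z = 0 then 1 else 0
  | m + 1, z => (1 - r) * walk r m z + r / 2 * walk r m (z - 1) + r / 2 * walk r m (z + 1)

/-- The walk's probability of the window `(-d, d]`, which by the reflection principle is the
probability that the walk started at `d` has not hit `0` within `m` steps. -/
noncomputable def walkWindow (r : ℝ) (m d : ℕ) : ℝ :=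
  ∑ j ∈ range d, (walk r m (j + 1) + walk r m (-j))

lemma walkWindow_one (r : ℝ) (m : ℕ) : walkWindow r m 1 = walk r m 0 + walk r m 1 := by
  simp [walkWindow, add_comm]

lemma walkWindow_zero_succ (r : ℝ) (d : ℕ) : walkWindow r 0 (d + 1) = 1 := by
  induction d with
  | zero => simp [walkWindow, walk]
  | succ d ih =>
    rw [walkWindow, sum_range_succ, ← walkWindow, ih]
    have h₁ : (((d + 1 : ℕ) : ℤ) + 1) ≠ 0 := by omega
    have h₂ : -((d + 1 : ℕ) : ℤ) ≠ 0 := by omega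
    simp only [walk, if_neg h₁, if_neg h₂, add_zero]

lemma walkWindow_succ_succ (r : ℝ) (m d : ℕ) :
    walkWindow r (m + 1) (d + 1) = (1 - r) * walkWindow r m (d + 1) +
      r / 2 * walkWindow r m (d + 2) + r / 2 * walkWindow r m d := by
  induction d with
  | zero =>
    simp only [walkWindow, walk, sum_range_succ, sum_range_zero]
    norm_num
    ring
  | succ d ih =>
    have hs : ∀ m d, walkWindow r m (d + 1) =
        walkWindow r m d + (walk r m (d + 1) + walk r m (-d)) := fun m d ↦ by
      simp [walkWindow, sum_range_succ]
    rw [hs (m + 1) (d + 1), ih, hs m (d + 2), hs m (d + 1)]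
    nth_rw 5 [hs m d]
    simp only [walk]
    push_cast
    ring_nf

lemma walk_nonneg {r : ℝ} (h₀ : 0 ≤ r) (h₁ : r ≤ 1) (m : ℕ) (z : ℤ) : 0 ≤ walk r m z := by
  induction m generalizing z with
  | zero => simp only [walk]; split_ifs <;> norm_num
  | succ m ih =>
    have := sub_nonneg.2 h₁
    have := ih z
    have := ih (z - 1)
    have := ih (z + 1)
    simp only [walk]
    positivity

/-- The reflection coupling: each factor `q • (x + y)` moves `x ^ d - y ^ d` to the neighbouring
exponents `d + 1` and `d - 1` with equal weights. -/
lemma abs_map_pow_sub_pow_mul_prod_le {A ι κ : Type*} [CommRing A] [Algebra ℝ A] [Fintype κ]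
    (M : Submonoid A) (L : A →ₗ[ℝ] ℝ) (hL : ∀ p ∈ M, L p ∈ Set.Icc (0 : ℝ) 1)
    {x y : A} (hx : x ∈ M) (hy : y ∈ M) {q : ℝ} (hq : 0 ≤ q) (s : Finset ι)
    (μ : ι → A) (ρ : ι → κ → ℝ) (u : ι → κ → A)
    (hμ : ∀ l ∈ s, μ l = q • (x + y) + ∑ c, ρ l c • u l c) (hu : ∀ l ∈ s, ∀ c, u l c ∈ M)
    (hρ : ∀ l ∈ s, ∀ c, 0 ≤ ρ l c) (hρ_sum : ∀ l ∈ s, ∑ c, ρ l c = 1 - 2 * q)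
    (d : ℕ) {p : A} (hp : p ∈ M) :
    |L ((x ^ d - y ^ d) * p * ∏ l ∈ s, μ l)| ≤ walkWindow (2 * q) s.card d := by
  classical
  induction s using Finset.induction_on generalizing d p with
  | empty =>
    cases d with
    | zero => simp [walkWindow]
    | succ d =>
      have h₁ := hL _ (M.mul_mem (M.pow_mem hx (d + 1)) hp)
      have h₂ := hL _ (M.mul_mem (M.pow_mem hy (d + 1)) hp)
      rw [prod_empty, mul_one, card_empty, walkWindow_zero_succ, sub_mul, map_sub, abs_le]
      constructor <;> linarith [h₁.1, h₁.2, h₂.1, h₂.2]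
  | insert l s hl ih =>
    cases d with
    | zero => simp [walkWindow]
    | succ d =>
      replace ih := fun d p (hp : p ∈ M) ↦ ih (fun l hl ↦ hμ l (mem_insert_of_mem hl))
        (fun l hl ↦ hu l (mem_insert_of_mem hl)) (fun l hl ↦ hρ l (mem_insert_of_mem hl))
        (fun l hl ↦ hρ_sum l (mem_insert_of_mem hl)) d (p := p) hp
      have hl' := mem_insert_self l s
      set P := ∏ l ∈ s, μ l
      have key : (x ^ (d + 1) - y ^ (d + 1)) * p * (μ l * P) =
          q • ((x ^ (d + 2) - y ^ (d + 2)) * p * P) + q • ((x ^ d - y ^ d) * (x * y * p) * P) +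
            ∑ c, ρ l c • ((x ^ (d + 1) - y ^ (d + 1)) * (u l c * p) * P) := by
        have hsum : ∑ c, ρ l c • ((x ^ (d + 1) - y ^ (d + 1)) * (u l c * p) * P) =
            (∑ c, ρ l c • u l c) * ((x ^ (d + 1) - y ^ (d + 1)) * p * P) := by
          rw [sum_mul]
          refine sum_congr rfl fun c _ ↦ ?_
          rw [smul_mul_assoc]
          congr 1
          ring
        rw [hsum, hμ l hl']
        simp only [Algebra.smul_def]
        ring
      rw [prod_insert hl, key, card_insert_of_notMem hl, walkWindow_succ_succ]
      simp only [map_add, map_smul, map_sum, smul_eq_mul]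
      have h₁ := ih (d + 2) p hp
      have h₂ := ih d _ (M.mul_mem (M.mul_mem hx hy) hp)
      have h₃ : |∑ c, ρ l c * L ((x ^ (d + 1) - y ^ (d + 1)) * (u l c * p) * P)| ≤
          (1 - 2 * q) * walkWindow (2 * q) s.card (d + 1) := by
        rw [← hρ_sum l hl', sum_mul]
        refine (abs_sum_le_sum_abs _ _).trans (sum_le_sum fun c _ ↦ ?_)
        rw [abs_mul, abs_of_nonneg (hρ l hl' c)]
        exact mul_le_mul_of_nonneg_left (ih _ _ (M.mul_mem (hu l hl' c) hp)) (hρ l hl' c)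
      have h₄ := mul_le_mul_of_nonneg_left h₁ hq
      have h₅ := mul_le_mul_of_nonneg_left h₂ hq
      rw [← abs_of_nonneg hq, ← abs_mul, abs_of_nonneg hq] at h₄ h₅
      have e : 2 * q / 2 = q := by ring
      rw [e]
      linarith [abs_add_le (q * L ((x ^ (d + 2) - y ^ (d + 2)) * p * P) +
        q * L ((x ^ d - y ^ d) * (x * y * p) * P))
        (∑ c, ρ l c * L ((x ^ (d + 1) - y ^ (d + 1)) * (u l c * p) * P)),
        abs_add_le (q * L ((x ^ (d + 2) - y ^ (d + 2)) * p * P))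
        (q * L ((x ^ d - y ^ d) * (x * y * p) * P))]

lemma sum_perturbW {k : ℕ} (hk : k ≠ 0) (δ : ℝ) (a : Fin k) : ∑ c, perturbW k δ a c = 1 := by
  have : (k : ℝ) ≠ 0 := by exact_mod_cast hk
  simp [perturbW, sum_add_distrib]
  field_simp
  ring

lemma perturbW_nonneg {k : ℕ} {δ : ℝ} (h₀ : 0 ≤ δ) (h₁ : δ ≤ 1) (a c : Fin k) :
    0 ≤ perturbW k δ a c := by
  have := sub_nonneg.2 h₁
  unfold perturbW
  split_ifs <;> positivity

lemma div_le_perturbW {k : ℕ} {δ : ℝ} (h₁ : δ ≤ 1) (a c : Fin k) :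
    δ / k ≤ perturbW k δ a c := by
  have := sub_nonneg.2 h₁
  unfold perturbW
  split_ifs <;> linarith

/-- The generating element of the perturbed action `a` when action `c` is encoded as `u c`. -/
noncomputable def perturbElt {A : Type*} [CommRing A] [Algebra ℝ A] {k : ℕ} (δ : ℝ)
    (u : Fin k → A) (a : Fin k) : A :=
  ∑ c, perturbW k δ a c • u c

section Encoding

variable {A : Type*} [CommRing A] [Algebra ℝ A] {n k : ℕ} {δ : ℝ}

lemma perturbElt_eq (u : Fin k → A) (a : Fin k) :
    perturbElt δ u a = (1 - δ) • u a + ∑ c, (δ / k) • u c := by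
  simp [perturbElt, perturbW, add_smul, sum_add_distrib, ite_smul, ← smul_sum]

lemma perturbElt_sub (u : Fin k → A) (a b : Fin k) :
    perturbElt δ u a - perturbElt δ u b = (1 - δ) • (u a - u b) := by
  rw [perturbElt_eq, perturbElt_eq, smul_sub]
  abel

lemma perturbGame_eq_map_prod (L : A →ₗ[ℝ] ℝ) (u : Fin n → Fin k → A)
    (g : (Fin n → Fin k) → Fin n → ℝ) (i : Fin n) (hg : ∀ b, L (∏ l, u l (b l)) = g b i)
    (a : Fin n → Fin k) :
    perturbGame n k δ g a i = L (∏ l, perturbElt δ (u l) (a l)) := by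
  simp only [perturbElt]
  rw [Fintype.prod_sum, map_sum]
  refine sum_congr rfl fun b _ ↦ ?_
  rw [Finset.prod_smul, map_smul, hg, smul_eq_mul, profW]

lemma perturbGame_sub (L : A →ₗ[ℝ] ℝ) (u : Fin n → Fin k → A)
    (g : (Fin n → Fin k) → Fin n → ℝ) (i : Fin n) (hg : ∀ b, L (∏ l, u l (b l)) = g b i)
    {a b : Fin n → Fin k} {j : Fin n} (hab : ∀ l, l ≠ j → a l = b l) :
    perturbGame n k δ g a i - perturbGame n k δ g b i = (1 - δ) *
      L ((u j (a j) - u j (b j)) * ∏ l ∈ univ.erase j, perturbElt δ (u l) (a l)) := by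
  rw [perturbGame_eq_map_prod L u g i hg, perturbGame_eq_map_prod L u g i hg, ← map_sub,
    ← mul_prod_erase _ _ (mem_univ j), ← mul_prod_erase _ _ (mem_univ j),
    ← prod_congr rfl fun l hl ↦ by rw [hab l (ne_of_mem_erase hl)], ← sub_mul, perturbElt_sub,
    smul_mul_assoc, map_smul, smul_eq_mul]

end Encoding

/-- The linear functional on an additive monoid algebra extending a function on the monoid. -/
noncomputable def extendLinear {V : Type*} (F : V → ℝ) : AddMonoidAlgebra ℝ V →ₗ[ℝ] ℝ :=
  Finsupp.linearCombination ℝ F ∘ₗ (AddMonoidAlgebra.coeffLinearEquiv ℝ).toLinearMap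

lemma extendLinear_single {V : Type*} (F : V → ℝ) (v : V) (t : ℝ) :
    extendLinear F (AddMonoidAlgebra.single v t) = t * F v := by
  simp [extendLinear]

lemma prod_single_one {V ι : Type*} [AddCommMonoid V] (s : Finset ι) (v : ι → V) :
    ∏ l ∈ s, AddMonoidAlgebra.single (v l) (1 : ℝ) =
      AddMonoidAlgebra.single (∑ l ∈ s, v l) 1 := by
  classical
  induction s using Finset.induction_on with
  | empty => simp [AddMonoidAlgebra.one_def]
  | insert l s hl ih =>
    rw [prod_insert hl, ih, AddMonoidAlgebra.single_mul_single, sum_insert hl, one_mul]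

/-- Player `l`'s contribution, when playing `c`, to the pair formed by the own action of player `i`
and the total action counts. -/
def ownAndCount (n k : ℕ) (i l : Fin n) (c : Fin k) : (Fin k → ℕ) × (Fin k → ℕ) :=
  (if l = i then Pi.single c 1 else 0, Pi.single c 1)

lemma sum_ownAndCount {n k : ℕ} (i : Fin n) (b : Fin n → Fin k) :
    ∑ l, ownAndCount n k i l (b l) = (Pi.single (b i) 1, actCount n k b) := by
  refine Prod.ext ?_ ?_
  · simp [ownAndCount, Prod.fst_sum]
  · ext c
    simp [ownAndCount, Prod.snd_sum, actCount, Pi.single_apply, eq_comm (a := c)]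

lemma exists_payoff_of_isAnonymous {n k : ℕ} {g : (Fin n → Fin k) → Fin n → ℝ}
    (hg : IsGame n k g) (ha : IsAnonymous n k g) (i : Fin n) :
    ∃ F : (Fin k → ℕ) × (Fin k → ℕ) → ℝ, (∀ v, F v ∈ Set.Icc (0 : ℝ) 1) ∧
      ∀ b, F (∑ l, ownAndCount n k i l (b l)) = g b i := by
  classical
  refine ⟨fun v ↦ if h : ∃ b : Fin n → Fin k, ∑ l, ownAndCount n k i l (b l) = v
    then g h.choose i else 0, fun v ↦ ?_, fun b ↦ ?_⟩
  · dsimp only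
    split_ifs
    · exact hg _ _
    · simp
  · have h : ∃ b' : Fin n → Fin k,
        ∑ l, ownAndCount n k i l (b' l) = ∑ l, ownAndCount n k i l (b l) := ⟨b, rfl⟩
    dsimp only
    rw [dif_pos h]
    have hs := Prod.mk.inj <|
      (sum_ownAndCount i _).symm.trans (h.choose_spec.trans (sum_ownAndCount i b))
    refine ha _ _ i ?_ (congrFun hs.2)
    have := congrFun hs.1 (b i)
    by_contra hne
    simp [Ne.symm hne] at this

lemma abs_perturbGame_sub_le {n k : ℕ} {δ : ℝ} (hδ₀ : 0 ≤ δ) (hδ₁ : δ ≤ 1)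
    {g : (Fin n → Fin k) → Fin n → ℝ} (hg : IsGame n k g) (ha : IsAnonymous n k g)
    {i j : Fin n} {a b : Fin n → Fin k} (hij : i ≠ j) (hj : a j ≠ b j)
    (hab : ∀ l, l ≠ j → a l = b l) :
    |perturbGame n k δ g a i - perturbGame n k δ g b i| ≤
      (1 - δ) * walkWindow (2 * (δ / k)) (n - 2) 1 := by
  classical
  obtain ⟨F, hF, hFg⟩ := exists_payoff_of_isAnonymous hg ha i
  let u : Fin n → Fin k → AddMonoidAlgebra ℝ ((Fin k → ℕ) × (Fin k → ℕ)) :=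
    fun l c ↦ AddMonoidAlgebra.single (ownAndCount n k i l c) 1
  have hu : ∀ b : Fin n → Fin k, extendLinear F (∏ l, u l (b l)) = g b i := fun b ↦ by
    simp only [u, prod_single_one, extendLinear_single, one_mul, hFg]
  rw [perturbGame_sub (extendLinear F) u g i hu hab, abs_mul, abs_of_nonneg (sub_nonneg.2 hδ₁)]
  refine mul_le_mul_of_nonneg_left ?_ (sub_nonneg.2 hδ₁)
  let M : Submonoid (AddMonoidAlgebra ℝ ((Fin k → ℕ) × (Fin k → ℕ))) :=
    { carrier := Set.range fun v ↦ AddMonoidAlgebra.single v 1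
      one_mem' := ⟨0, rfl⟩
      mul_mem' := by
        rintro _ _ ⟨v, rfl⟩ ⟨w, rfl⟩
        exact ⟨v + w, by simp [AddMonoidAlgebra.single_mul_single]⟩ }
  have hL : ∀ p ∈ M, extendLinear F p ∈ Set.Icc (0 : ℝ) 1 := by
    rintro _ ⟨v, rfl⟩
    simpa only [extendLinear_single, one_mul] using hF v
  have huM : ∀ l c, u l c ∈ M := fun l c ↦ ⟨_, rfl⟩
  have hk : k ≠ 0 := fun h ↦ by subst h; exact (a j).elim0
  have hu_eq : ∀ l c, l ≠ i → u l c = u j c := fun l c hl ↦ by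
    simp [u, ownAndCount, hl, hij.symm]
  let ρ : Fin k → Fin k → ℝ :=
    fun e c ↦ perturbW k δ e c - (if c = a j then δ / k else 0) - if c = b j then δ / k else 0
  have hρ_nonneg : ∀ e c, 0 ≤ ρ e c := fun e c ↦ by
    have h₁ := perturbW_nonneg hδ₀ hδ₁ e c
    have h₂ := div_le_perturbW hδ₁ e c
    simp only [ρ]
    by_cases hca : c = a j
    · have : c ≠ b j := fun h ↦ hj (hca.symm.trans h)
      rw [if_pos hca, if_neg this]
      linarith
    · rw [if_neg hca]
      split_ifs <;> linarith
  have hρ_sum : ∀ e, ∑ c, ρ e c = 1 - 2 * (δ / k) := fun e ↦ by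
    simp only [ρ, sum_sub_distrib, sum_perturbW hk, sum_ite_eq', mem_univ, if_true]
    ring
  have hμ : ∀ l, l ≠ i → perturbElt δ (u l) (a l) =
      (δ / k) • (u j (a j) + u j (b j)) + ∑ c, ρ (a l) c • u l c := fun l hl ↦ by
    simp only [ρ, sub_smul, sum_sub_distrib, ite_smul, zero_smul, sum_ite_eq', mem_univ, if_true,
      perturbElt, smul_add, hu_eq l _ hl]
    abel
  have hi : i ∈ (univ : Finset (Fin n)).erase j := mem_erase.2 ⟨hij, mem_univ i⟩
  have hcard : (((univ : Finset (Fin n)).erase j).erase i).card = n - 2 := by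
    rw [card_erase_of_mem hi, card_erase_of_mem (mem_univ j), card_univ, Fintype.card_fin]
    omega
  have hbound := fun c ↦ abs_map_pow_sub_pow_mul_prod_le M (extendLinear F) hL (huM j (a j))
    (huM j (b j)) (q := δ / k) (by positivity) ((univ.erase j).erase i)
    (fun l ↦ perturbElt δ (u l) (a l)) (fun l ↦ ρ (a l)) u (fun l hl ↦ hμ l (ne_of_mem_erase hl))
    (fun l _ ↦ huM l) (fun l _ ↦ hρ_nonneg (a l)) (fun l _ ↦ hρ_sum (a l)) 1 (huM i c)
  rw [hcard] at hbound
  simp only [pow_one] at hbound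
  rw [← mul_prod_erase _ _ hi, perturbElt, sum_mul, mul_sum, map_sum,
    ← one_mul (walkWindow _ _ _), ← sum_perturbW hk δ (a i), sum_mul]
  refine (abs_sum_le_sum_abs _ _).trans (sum_le_sum fun c _ ↦ ?_)
  rw [smul_mul_assoc, mul_smul_comm, ← mul_assoc, map_smul, smul_eq_mul, abs_mul,
    abs_of_nonneg (perturbW_nonneg hδ₀ hδ₁ _ _)]
  exact mul_le_mul_of_nonneg_left (hbound c) (perturbW_nonneg hδ₀ hδ₁ _ _)

lemma le_of_mem_lipC_perturbGame {n k : ℕ} {δ : ℝ} (hδ₀ : 0 ≤ δ) (hδ₁ : δ ≤ 1)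
    {g : (Fin n → Fin k) → Fin n → ℝ} (hg : IsGame n k g) (ha : IsAnonymous n k g)
    {x : ℝ} (hx : x ∈ {x | ∃ (i : Fin n) (a b : Fin n → Fin k), a i = b i ∧
      (univ.filter fun j => a j ≠ b j).card = 1 ∧
        x = |perturbGame n k δ g a i - perturbGame n k δ g b i|}) :
    x ≤ (1 - δ) * walkWindow (2 * (δ / k)) (n - 2) 1 := by
  obtain ⟨i, a, b, hi, hcard, rfl⟩ := hx
  obtain ⟨j, hj⟩ := card_eq_one.1 hcard
  have hmem : ∀ l, a l ≠ b l ↔ l = j := fun l ↦ by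
    simpa using congrArg (l ∈ ·) hj
  exact abs_perturbGame_sub_le hδ₀ hδ₁ hg ha (fun h ↦ (hmem i).2 h hi) ((hmem j).2 rfl)
    fun l hl ↦ by_contra fun h ↦ hl ((hmem l).1 h)

lemma pow_eq_sum_walk (q : ℝ) (m : ℕ) (z : ℤ) :
    ((AddMonoidAlgebra.single (0 : ℤ) (1 - 2 * q) + AddMonoidAlgebra.single 1 q +
      AddMonoidAlgebra.single (-1) q) ^ m).coeff z = walk (2 * q) m z := by
  induction m generalizing z with
  | zero =>
    simp only [pow_zero, walk, AddMonoidAlgebra.one_def, AddMonoidAlgebra.coeff_single,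
      Finsupp.single_apply, eq_comm (a := (0 : ℤ))]
  | succ m ih =>
    rw [pow_succ, mul_add, mul_add, AddMonoidAlgebra.coeff_add, AddMonoidAlgebra.coeff_add,
      Finsupp.add_apply, Finsupp.add_apply,
      AddMonoidAlgebra.coeff_mul_single_eq_coeff_mul z (by intros; omega),
      AddMonoidAlgebra.coeff_mul_single_eq_coeff_mul (z - 1) (by intros; omega),
      AddMonoidAlgebra.coeff_mul_single_eq_coeff_mul (z + 1) (by intros; omega), ih, ih, ih, walk]
    ring

/-- The signed indicator of playing action `x` against playing action `y`. -/
def actSign {k : ℕ} (x y c : Fin k) : ℤ := (if c = x then 1 else 0) - if c = y then 1 else 0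

/-- Player `i` is paid iff more opponents play `x` than `y`. -/
def majorityGame {n k : ℕ} (x y : Fin k) (a : Fin n → Fin k) (i : Fin n) : ℝ :=
  if 1 ≤ ∑ l, (if l = i then 0 else actSign x y (a l)) then 1 else 0

lemma isGame_majorityGame {n k : ℕ} (x y : Fin k) : IsGame n k (majorityGame x y) := by
  intro a i
  unfold majorityGame
  split_ifs <;> simp

lemma isAnonymous_majorityGame {n k : ℕ} (x y : Fin k) : IsAnonymous n k (majorityGame x y) := by
  have h : ∀ (a : Fin n → Fin k) i, ∑ l, (if l = i then 0 else actSign x y (a l)) =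
      actCount n k a x - actCount n k a y - actSign x y (a i) := fun a i ↦ by
    have : ∀ l, (if l = i then 0 else actSign x y (a l)) =
        actSign x y (a l) - if l = i then actSign x y (a l) else 0 := fun l ↦ by
      split_ifs <;> simp
    rw [sum_congr rfl fun l _ ↦ this l]
    simp [sum_sub_distrib, actSign, actCount]
  intro a b i hi hc
  simp only [majorityGame, h, hi, hc]

lemma perturbElt_single_actSign {k : ℕ} (hk : k ≠ 0) (δ : ℝ) {x y z : Fin k} (hxy : x ≠ y)
    (hzx : z ≠ x) (hzy : z ≠ y) :
    perturbElt δ (fun c ↦ AddMonoidAlgebra.single (actSign x y c) (1 : ℝ)) z =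
      AddMonoidAlgebra.single 0 (1 - 2 * (δ / k)) + AddMonoidAlgebra.single 1 (δ / k) +
        AddMonoidAlgebra.single (-1) (δ / k) := by
  have hk' : (k : ℝ) ≠ 0 := by exact_mod_cast hk
  have h : ∀ c, AddMonoidAlgebra.single (actSign x y c) (1 : ℝ) = AddMonoidAlgebra.single 0 1 +
      (if c = x then AddMonoidAlgebra.single 1 1 - AddMonoidAlgebra.single 0 1 else 0) +
      (if c = y then AddMonoidAlgebra.single (-1) 1 - AddMonoidAlgebra.single 0 1 else 0) :=
    fun c ↦ by
      by_cases hx : c = x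
      · subst hx; simp [actSign, hxy]
      · by_cases hy : c = y <;> simp [actSign, hx, hy, hxy.symm]
  have hs : ∀ (v : ℤ) (t : ℝ), AddMonoidAlgebra.single v t = t • AddMonoidAlgebra.single v 1 :=
    fun v t ↦ by rw [AddMonoidAlgebra.smul_single, smul_eq_mul, mul_one]
  rw [perturbElt_eq, ← smul_sum]
  simp only [h, sum_add_distrib, sum_ite_eq', mem_univ, if_true, if_neg hzx, if_neg hzy, sum_const,
    card_univ, Fintype.card_fin, add_zero, ← Nat.cast_smul_eq_nsmul ℝ]
  rw [hs 0 (1 - _), hs 1 (δ / k), hs (-1) (δ / k)]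
  have : δ / k * k = δ := by field_simp
  simp only [smul_add, smul_sub, smul_smul, this]
  module

lemma extendLinear_single_sub_mul (p : AddMonoidAlgebra ℝ ℤ) :
    extendLinear (fun z : ℤ ↦ if 1 ≤ z then 1 else 0)
      ((AddMonoidAlgebra.single 1 1 - AddMonoidAlgebra.single (-1) 1) * p) =
        p.coeff 0 + p.coeff 1 := by
  induction p using AddMonoidAlgebra.induction_linear with
  | zero => simp
  | add p q hp hq =>
    rw [mul_add, map_add, hp, hq]
    simp only [AddMonoidAlgebra.coeff_add, Finsupp.add_apply]
    ring
  | single z t =>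
    rw [sub_mul, AddMonoidAlgebra.single_mul_single, AddMonoidAlgebra.single_mul_single, map_sub,
      extendLinear_single, extendLinear_single]
    simp only [AddMonoidAlgebra.coeff_single, Finsupp.single_apply]
    split_ifs <;> first | omega | simp

lemma perturbGame_majorityGame_sub {n k : ℕ} (δ : ℝ) {x y z : Fin k} (hxy : x ≠ y) (hzx : z ≠ x)
    (hzy : z ≠ y) {i j : Fin n} (hij : i ≠ j) :
    perturbGame n k δ (majorityGame x y) (Function.update (fun _ ↦ z) j x) i -
      perturbGame n k δ (majorityGame x y) (Function.update (fun _ ↦ z) j y) i =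
        (1 - δ) * (walk (2 * (δ / k)) (n - 2) 0 + walk (2 * (δ / k)) (n - 2) 1) := by
  have hk : k ≠ 0 := fun h ↦ by subst h; exact x.elim0
  let u : Fin n → Fin k → AddMonoidAlgebra ℝ ℤ :=
    fun l c ↦ AddMonoidAlgebra.single (if l = i then 0 else actSign x y c) 1
  have hu : ∀ b : Fin n → Fin k, extendLinear (fun z : ℤ ↦ if 1 ≤ z then 1 else 0)
      (∏ l, u l (b l)) = majorityGame x y b i := fun b ↦ by
    simp only [u, prod_single_one, extendLinear_single, one_mul, majorityGame]
  have hi : i ∈ (univ : Finset (Fin n)).erase j := mem_erase.2 ⟨hij, mem_univ i⟩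
  have hcard : (((univ : Finset (Fin n)).erase j).erase i).card = n - 2 := by
    rw [card_erase_of_mem hi, card_erase_of_mem (mem_univ j), card_univ, Fintype.card_fin]
    omega
  have hui : ∀ c, perturbElt δ (u i) c = 1 := fun c ↦ by
    simp only [perturbElt, u, if_true, ← AddMonoidAlgebra.one_def, ← sum_smul, sum_perturbW hk,
      one_smul]
  rw [perturbGame_sub _ u _ i hu (j := j) fun l hl ↦ by simp [hl], ← mul_prod_erase _ _ hi, hui,
    one_mul, Function.update_self, Function.update_self,
    prod_congr rfl (g := fun _ ↦ _) fun l hl ↦ ?_, prod_const, hcard]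
  rotate_left
  · have hl' := mem_erase.1 hl
    rw [Function.update_of_ne (ne_of_mem_erase hl'.2)]
    simp only [u, if_neg hl'.1]
    exact perturbElt_single_actSign hk δ hxy hzx hzy
  · simp only [u, if_neg hij.symm, actSign, if_true, if_neg hxy, if_neg hxy.symm, sub_zero, zero_sub]
    rw [extendLinear_single_sub_mul, pow_eq_sum_walk, pow_eq_sum_walk]

/-- The worst-case Lipschitz constant of `δ`-perturbed `n`-player `k`-action
anonymous games, for `n ≥ 2` and `k ≥ 3`, equals `(1-δ)·P(S_{n-2}^{2δ/k} ∈ {0,1})`. -/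
theorem lipschitz_constant_eq_walk_prob (n k : ℕ) (hn : 2 ≤ n) (hk : 3 ≤ k)
    (δ : ℝ) (hδ : δ ∈ Set.Ioo (0 : ℝ) 1) :
    lam n k δ = (1 - δ) * (walk (2 * δ / k) (n - 2) 0 + walk (2 * δ / k) (n - 2) 1) := by
  have hδ₀ := hδ.1.le
  have hδ₁ := hδ.2.le
  have hk₃ : (3 : ℝ) ≤ k := by exact_mod_cast hk
  have hr₁ : 2 * (δ / k) ≤ 1 := by
    rw [← mul_div_assoc, div_le_one (by linarith)]
    linarith
  have hr₀ : 0 ≤ 2 * (δ / k) := by positivity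
  rw [mul_div_assoc]
  have hw : 0 ≤ (1 - δ) * walkWindow (2 * (δ / k)) (n - 2) 1 := by
    rw [walkWindow_one]
    exact mul_nonneg (sub_nonneg.2 hδ₁)
      (add_nonneg (walk_nonneg hr₀ hr₁ _ _) (walk_nonneg hr₀ hr₁ _ _))
  have hlip : ∀ g, IsGame n k g → IsAnonymous n k g →
      lipC n k (perturbGame n k δ g) ≤ (1 - δ) * walkWindow (2 * (δ / k)) (n - 2) 1 :=
    fun g hg ha ↦ Real.sSup_le (fun _ hx ↦ le_of_mem_lipC_perturbGame hδ₀ hδ₁ hg ha hx) hw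
  rw [← walkWindow_one]
  refine le_antisymm (Real.sSup_le ?_ hw) ?_
  · rintro _ ⟨g, hg, ha, rfl⟩
    exact hlip g hg ha
  let x : Fin k := ⟨0, by omega⟩
  let y : Fin k := ⟨1, by omega⟩
  let z : Fin k := ⟨2, by omega⟩
  let i : Fin n := ⟨0, by omega⟩
  let j : Fin n := ⟨1, by omega⟩
  have hxy : x ≠ y := by simp [x, y]
  have hij : i ≠ j := by simp [i, j]
  have hg := isGame_majorityGame (n := n) x y
  have ha := isAnonymous_majorityGame (n := n) x y
  refine le_trans ?_ (le_csSup ⟨(1 - δ) * walkWindow (2 * (δ / k)) (n - 2) 1, ?_⟩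
    ⟨majorityGame x y, hg, ha, rfl⟩)
  · refine le_csSup ⟨_, fun _ hx ↦ le_of_mem_lipC_perturbGame hδ₀ hδ₁ hg ha hx⟩
      ⟨i, Function.update (fun _ ↦ z) j x, Function.update (fun _ ↦ z) j y, ?_, ?_, ?_⟩
    · simp [hij]
    · refine card_eq_one.2 ⟨j, ?_⟩
      ext l
      by_cases hl : l = j
      · subst hl; simp [hxy]
      · simp [hl]
    · rw [perturbGame_majorityGame_sub δ hxy (by simp [z, x]) (by simp [z, y]) hij,
        ← walkWindow_one, abs_of_nonneg hw]
  · rintro _ ⟨g, hg, ha, rfl⟩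
    exact hlip g hg ha
end

section
/- For every n ≥ 1 and every δ ∈ (0,1), writing λ_m = λ(m,2,δ) for the worst-case Lipschitz constant of δ-perturbed m-player 2-action anonymous games, one has λ_{2n+2} ≤ λ_{2n+1} ≤ √(λ_{2n}·λ_{2n+2}). -/
open Finset

/-- The number of players choosing action `1` in a two-action profile. -/
def ones {N : ℕ} (c : Fin N → Fin 2) : ℤ := ∑ l, ((c l).val : ℤ)

/-- The distribution of the number of players choosing action `1` in the perturbation of `a`. -/
noncomputable def onesLaw (δ : ℝ) {N : ℕ} (a : Fin N → Fin 2) (z : ℤ) : ℝ :=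
  ∑ c : Fin N → Fin 2, if ones c = z then profW N 2 δ a c else 0

lemma perturbW_two_nonneg {δ : ℝ} (hδ : δ ∈ Set.Ioo (0 : ℝ) 1) (x y : Fin 2) :
    0 ≤ perturbW 2 δ x y := by
  obtain ⟨h0, h1⟩ := hδ
  unfold perturbW
  split_ifs <;> push_cast <;> linarith

lemma perturbW_two_add (δ : ℝ) (x : Fin 2) : perturbW 2 δ x 0 + perturbW 2 δ x 1 = 1 := by
  fin_cases x <;> simp [perturbW] <;> ring

lemma ones_nonneg {N : ℕ} (c : Fin N → Fin 2) : 0 ≤ ones c :=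
  Finset.sum_nonneg fun _ _ => by positivity

lemma ones_le {N : ℕ} (c : Fin N → Fin 2) : ones c ≤ N := by
  unfold ones
  calc ∑ l, ((c l).val : ℤ) ≤ ∑ _l : Fin N, (1 : ℤ) :=
        Finset.sum_le_sum fun l _ => by have := (c l).isLt; omega
    _ = N := by simp

lemma ones_insertNth {N : ℕ} (p : Fin (N + 1)) (x : Fin 2) (c : Fin N → Fin 2) :
    ones (p.insertNth x c : Fin (N + 1) → Fin 2) = (x.val : ℤ) + ones c := by
  simp [ones, Fin.sum_univ_succAbove _ p]

lemma profW_insertNth {N : ℕ} (δ : ℝ) (p : Fin (N + 1)) (a : Fin (N + 1) → Fin 2) (x : Fin 2)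
    (c : Fin N → Fin 2) :
    profW (N + 1) 2 δ a (p.insertNth x c : Fin (N + 1) → Fin 2) =
      perturbW 2 δ (a p) x * profW N 2 δ (fun l => a (p.succAbove l)) c := by
  simp [profW, Fin.prod_univ_succAbove _ p]

lemma sum_insertNth {N : ℕ} (p : Fin (N + 1)) (F : (Fin (N + 1) → Fin 2) → ℝ) :
    ∑ b, F b = ∑ x : Fin 2, ∑ c : Fin N → Fin 2, F (p.insertNth x c : Fin (N + 1) → Fin 2) := by
  rw [← (Fin.insertNthEquiv (fun _ => Fin 2) p).sum_comp, Fintype.sum_prod_type]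
  rfl

lemma profW_nonneg {δ : ℝ} (hδ : δ ∈ Set.Ioo (0 : ℝ) 1) {N : ℕ} (a c : Fin N → Fin 2) :
    0 ≤ profW N 2 δ a c :=
  Finset.prod_nonneg fun _ _ => perturbW_two_nonneg hδ _ _

lemma onesLaw_nonneg {δ : ℝ} (hδ : δ ∈ Set.Ioo (0 : ℝ) 1) {N : ℕ} (a : Fin N → Fin 2) (z : ℤ) :
    0 ≤ onesLaw δ a z :=
  Finset.sum_nonneg fun c _ => by split_ifs <;> [exact profW_nonneg hδ a c; exact le_rfl]

lemma onesLaw_zero (δ : ℝ) (a : Fin 0 → Fin 2) (z : ℤ) :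
    onesLaw δ a z = if z = 0 then 1 else 0 := by
  simp [onesLaw, ones, profW, eq_comm]

lemma onesLaw_succ (δ : ℝ) {N : ℕ} (a : Fin (N + 1) → Fin 2) (z : ℤ) :
    onesLaw δ a z = perturbW 2 δ (a 0) 0 * onesLaw δ (fun l => a l.succ) z +
      perturbW 2 δ (a 0) 1 * onesLaw δ (fun l => a l.succ) (z - 1) := by
  unfold onesLaw
  rw [sum_insertNth 0]
  simp only [ones_insertNth, profW_insertNth, Fin.sum_univ_two, Finset.mul_sum, mul_ite, mul_zero,
    Fin.succAbove_zero]
  congr 1 <;> refine Finset.sum_congr rfl fun c _ => ?_ <;> congr 1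
  · simp
  · simp only [Fin.val_one, eq_iff_iff]
    push_cast
    constructor <;> intro h <;> linarith

lemma onesLaw_le_one {δ : ℝ} (hδ : δ ∈ Set.Ioo (0 : ℝ) 1) {N : ℕ} (a : Fin N → Fin 2) (z : ℤ) :
    onesLaw δ a z ≤ 1 := by
  induction N generalizing z with
  | zero => rw [onesLaw_zero]; split_ifs <;> norm_num
  | succ N ih =>
    rw [onesLaw_succ]
    nlinarith [perturbW_two_add δ (a 0), ih (fun l => a l.succ) z, ih (fun l => a l.succ) (z - 1),
      perturbW_two_nonneg hδ (a 0) 0, perturbW_two_nonneg hδ (a 0) 1]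

lemma onesLaw_logConcave {δ : ℝ} (hδ : δ ∈ Set.Ioo (0 : ℝ) 1) {N : ℕ} (a : Fin N → Fin 2)
    {i j : ℤ} (hij : i ≤ j) :
    onesLaw δ a (i - 1) * onesLaw δ a (j + 1) ≤ onesLaw δ a i * onesLaw δ a j := by
  induction N generalizing i j with
  | zero =>
    have h : onesLaw δ a (i - 1) * onesLaw δ a (j + 1) = 0 := by
      simp only [onesLaw_zero]
      split_ifs <;> first | omega | simp
    rw [h]
    exact mul_nonneg (onesLaw_nonneg hδ a i) (onesLaw_nonneg hδ a j)
  | succ N ih =>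
    simp only [onesLaw_succ δ a]
    set f := onesLaw δ fun l => a l.succ
    have ih' : ∀ {i j : ℤ}, i ≤ j → f (i - 1) * f (j + 1) ≤ f i * f j :=
      fun h => ih (fun l => a l.succ) h
    have hp := perturbW_two_nonneg hδ (a 0) 0
    have hq := perturbW_two_nonneg hδ (a 0) 1
    set p := perturbW 2 δ (a 0) 0
    set q := perturbW 2 δ (a 0) 1
    have h1 := ih' hij
    have h2 : f (i - 1 - 1) * f j ≤ f (i - 1) * f (j - 1) := by
      have := ih' (i := i - 1) (j := j - 1) (by omega)
      rwa [sub_add_cancel] at this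
    have h3 : f (i - 1 - 1) * f (j + 1) ≤ f i * f (j - 1) := by
      have h4 := ih' (i := i - 1) (j := j) (by omega)
      rcases hij.eq_or_lt with rfl | h
      · linarith
      · have h5 := ih' (i := i) (j := j - 1) (by omega)
        rw [sub_add_cancel] at h5
        exact h4.trans h5
    rw [add_sub_cancel_right]
    nlinarith [mul_le_mul_of_nonneg_left h1 (mul_nonneg hp hp),
      mul_le_mul_of_nonneg_left h2 (mul_nonneg hq hq),
      mul_le_mul_of_nonneg_left h3 (mul_nonneg hp hq)]

/-- Summation against the increments of a `[0,1]`-valued function, for a unimodal sequence. -/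
lemma sum_mul_increment_le {f h : ℕ → ℝ} {C : ℝ} (hf : ∀ k, 0 ≤ f k) (hC : ∀ k, f k ≤ C)
    (hu : ∀ k n, k < n → f (k + 1) < f k → f (n + 1) ≤ f n)
    (h0 : ∀ k, 0 ≤ h k) (h1 : ∀ k, h k ≤ 1) (n : ℕ) :
    ∑ k ∈ range (n + 1), f k * (h (k + 1) - h k) ≤ C := by
  suffices H : ∑ k ∈ range (n + 1), f k * (h (k + 1) - h k) ≤ f n * h (n + 1) ∨
      (∃ k < n, f (k + 1) < f k) ∧
        ∑ k ∈ range (n + 1), f k * (h (k + 1) - h k) ≤ C - f n * (1 - h (n + 1)) by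
    rcases H with H | ⟨-, H⟩
    · nlinarith [hf n, hC n, h1 (n + 1)]
    · nlinarith [hf n, h1 (n + 1)]
  induction n with
  | zero =>
    left
    simp only [zero_add, sum_range_one]
    nlinarith [hf 0, h0 0]
  | succ n ih =>
    rw [sum_range_succ]
    rcases ih with ih | ⟨⟨k, hk, hlt⟩, ih⟩
    · rcases le_or_gt (f n) (f (n + 1)) with hn | hn
      · left
        nlinarith [h0 (n + 1)]
      · right
        exact ⟨⟨n, n.lt_succ_self, hn⟩, by nlinarith [hC n, h1 (n + 1)]⟩
    · right
      exact ⟨⟨k, hk.trans n.lt_succ_self, hlt⟩, by nlinarith [hu k n hk hlt, h1 (n + 1)]⟩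

lemma onesLaw_antitone_after {δ : ℝ} (hδ : δ ∈ Set.Ioo (0 : ℝ) 1) {N : ℕ} (a : Fin N → Fin 2)
    (k n : ℕ) (hkn : k < n) (h : onesLaw δ a ((k + 1 : ℕ) : ℤ) < onesLaw δ a (k : ℤ)) :
    onesLaw δ a ((n + 1 : ℕ) : ℤ) ≤ onesLaw δ a (n : ℤ) := by
  have hl := onesLaw_logConcave hδ a (i := ((k + 1 : ℕ) : ℤ)) (j := (n : ℤ)) (by omega)
  have hk : ((k + 1 : ℕ) : ℤ) - 1 = k := by push_cast; ring
  rw [hk, ← Nat.cast_succ] at hl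
  have h0 := onesLaw_nonneg hδ a ((k + 1 : ℕ) : ℤ)
  have hn := onesLaw_nonneg hδ a (n : ℤ)
  refine le_of_mul_le_mul_left (hl.trans ?_) (h0.trans_lt h)
  exact mul_le_mul_of_nonneg_right h.le hn

lemma sum_profW_mul (δ : ℝ) {N : ℕ} (a : Fin N → Fin 2) (F : ℤ → ℝ) :
    ∑ c, profW N 2 δ a c * F (ones c) = ∑ k ∈ range (N + 1), onesLaw δ a (k : ℤ) * F k := by
  simp only [onesLaw, Finset.sum_mul]
  rw [Finset.sum_comm]
  refine Finset.sum_congr rfl fun c _ => ?_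
  have h0 := ones_nonneg c
  have h1 := ones_le c
  rw [Finset.sum_eq_single (ones c).toNat]
  · rw [Int.toNat_of_nonneg h0, if_pos rfl]
  · intro k _ hk
    rw [if_neg (by omega), zero_mul]
  · intro h
    exact absurd (Finset.mem_range.2 (by omega)) h

lemma perturbGame_insertNth (δ : ℝ) {N : ℕ} {g : (Fin (N + 2) → Fin 2) → Fin (N + 2) → ℝ}
    {i : Fin (N + 2)} {H : Fin 2 → ℤ → ℝ} (hH : ∀ b, g b i = H (b i) (ones b - (b i).val))
    (j : Fin (N + 1)) (A : Fin (N + 2) → Fin 2) :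
    perturbGame (N + 2) 2 δ g A i = ∑ x : Fin 2, perturbW 2 δ (A i) x * ∑ y : Fin 2,
      perturbW 2 δ (A (i.succAbove j)) y * ∑ k ∈ range (N + 1),
        onesLaw δ (fun l => A (i.succAbove (j.succAbove l))) (k : ℤ) * H x (y.val + k) := by
  unfold perturbGame
  rw [sum_insertNth i]
  refine Finset.sum_congr rfl fun x _ => ?_
  rw [sum_insertNth j, Finset.mul_sum]
  refine Finset.sum_congr rfl fun y _ => ?_
  rw [← sum_profW_mul δ _ fun k => H x (y.val + k), Finset.mul_sum, Finset.mul_sum]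
  refine Finset.sum_congr rfl fun c _ => ?_
  rw [hH, profW_insertNth, profW_insertNth, ones_insertNth, ones_insertNth,
    Fin.insertNth_apply_same, add_sub_cancel_left]
  ring

lemma perturbGame_sub_s2 (δ : ℝ) {N : ℕ} {g : (Fin (N + 2) → Fin 2) → Fin (N + 2) → ℝ}
    {i : Fin (N + 2)} {H : Fin 2 → ℤ → ℝ} (hH : ∀ b, g b i = H (b i) (ones b - (b i).val))
    (j : Fin (N + 1)) {A B : Fin (N + 2) → Fin 2} (hAB : ∀ l, l ≠ i.succAbove j → A l = B l)
    (hA : A (i.succAbove j) = 1) (hB : B (i.succAbove j) = 0) :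
    perturbGame (N + 2) 2 δ g A i - perturbGame (N + 2) 2 δ g B i =
      (1 - δ) * ∑ x : Fin 2, perturbW 2 δ (A i) x * ∑ k ∈ range (N + 1),
        onesLaw δ (fun l => A (i.succAbove (j.succAbove l))) (k : ℤ) *
          (H x ((k + 1 : ℕ) : ℤ) - H x (k : ℤ)) := by
  rw [perturbGame_insertNth δ hH j, perturbGame_insertNth δ hH j, hA, hB,
    ← hAB i (Fin.succAbove_ne i j).symm]
  have h : (fun l => B (i.succAbove (j.succAbove l))) =
      fun l => A (i.succAbove (j.succAbove l)) := by
    funext l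
    refine (hAB _ fun h => ?_).symm
    exact Fin.succAbove_ne j l (Fin.succAbove_right_injective h)
  have h10 : perturbW 2 δ 1 0 = δ / 2 := by simp [perturbW]
  have h01 : perturbW 2 δ 0 1 = δ / 2 := by simp [perturbW]
  have h11 : perturbW 2 δ 1 1 = 1 - δ + δ / 2 := by simp [perturbW]
  have h00 : perturbW 2 δ 0 0 = 1 - δ + δ / 2 := by simp [perturbW]
  rw [h]
  simp only [Fin.sum_univ_two (f := fun y : Fin 2 => perturbW 2 δ _ y * _), h10, h01, h11, h00,
    mul_sub, Finset.sum_sub_distrib, Fin.val_zero, Fin.val_one, Nat.cast_zero, Nat.cast_one,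
    zero_add, Nat.cast_add, add_comm (1 : ℤ)]
  ring

lemma actCount_one {N : ℕ} (b : Fin N → Fin 2) : (actCount N 2 b 1 : ℤ) = ones b := by
  rw [actCount, Finset.card_filter, ones]
  push_cast
  refine Finset.sum_congr rfl fun l _ => ?_
  generalize b l = x
  fin_cases x <;> simp

lemma actCount_zero {N : ℕ} (b : Fin N → Fin 2) : (actCount N 2 b 0 : ℤ) = N - ones b := by
  have h : (N : ℤ) = ∑ _l : Fin N, 1 := by simp
  rw [actCount, Finset.card_filter, ones, h, ← Finset.sum_sub_distrib]
  push_cast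
  refine Finset.sum_congr rfl fun l _ => ?_
  generalize b l = x
  fin_cases x <;> simp

lemma IsAnonymous.exists_payoff {N : ℕ} {g : (Fin N → Fin 2) → Fin N → ℝ} (hg : IsGame N 2 g)
    (ha : IsAnonymous N 2 g) (i : Fin N) :
    ∃ H : Fin 2 → ℤ → ℝ, (∀ x k, H x k ∈ Set.Icc (0 : ℝ) 1) ∧
      ∀ b, g b i = H (b i) (ones b - (b i).val) := by
  classical
  refine ⟨fun x k => if h : ∃ b : Fin N → Fin 2, b i = x ∧ ones b - (x.val : ℤ) = k then
    g h.choose i else 0, fun x k => ?_, fun b => ?_⟩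
  · dsimp only
    split_ifs
    · exact hg _ i
    · simp
  · have h : ∃ b' : Fin N → Fin 2, b' i = b i ∧
        ones b' - ((b i).val : ℤ) = ones b - ((b i).val : ℤ) := ⟨b, rfl, rfl⟩
    dsimp only
    rw [dif_pos h]
    have hs := h.choose_spec
    refine ha _ _ i hs.1.symm fun j => ?_
    have h1 : ones b = ones h.choose := by linarith [hs.2]
    have h2 := actCount_one b
    have h3 := actCount_one h.choose
    have h4 := actCount_zero b
    have h5 := actCount_zero h.choose
    fin_cases j <;> simp only [Fin.zero_eta, Fin.mk_one] <;> omega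

lemma abs_perturbGame_sub_le_s2 {δ : ℝ} (hδ : δ ∈ Set.Ioo (0 : ℝ) 1) {N : ℕ} {C : ℝ}
    (hC : ∀ (a : Fin N → Fin 2) (z : ℤ), (1 - δ) * onesLaw δ a z ≤ C)
    {g : (Fin (N + 2) → Fin 2) → Fin (N + 2) → ℝ} (hg : IsGame (N + 2) 2 g)
    (ha : IsAnonymous (N + 2) 2 g) {i : Fin (N + 2)} {a b : Fin (N + 2) → Fin 2}
    (hab : a i = b i) (hcard : (Finset.univ.filter fun j => a j ≠ b j).card = 1) :
    |perturbGame (N + 2) 2 δ g a i - perturbGame (N + 2) 2 δ g b i| ≤ C := by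
  obtain ⟨H, hH01, hH⟩ := ha.exists_payoff hg i
  obtain ⟨j, hj⟩ := Finset.card_eq_one.1 hcard
  have hmem : ∀ l, a l ≠ b l ↔ l = j := fun l => by
    rw [← Finset.mem_singleton, ← hj]
    simp
  have hji : j ≠ i := fun h => (hmem j).2 rfl (h ▸ hab)
  obtain ⟨j, rfl⟩ := Fin.exists_succAbove_eq hji
  have hne := (hmem _).2 rfl
  have hδ1 : 0 < 1 - δ := sub_pos.2 hδ.2
  have key : ∀ A B : Fin (N + 2) → Fin 2, (∀ l, l ≠ i.succAbove j → A l = B l) →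
      A (i.succAbove j) = 1 → B (i.succAbove j) = 0 →
      |perturbGame (N + 2) 2 δ g A i - perturbGame (N + 2) 2 δ g B i| ≤ C := by
    intro A B hAB hA hB
    rw [perturbGame_sub_s2 δ hH j hAB hA hB]
    set f : ℕ → ℝ := fun k => onesLaw δ (fun l => A (i.succAbove (j.succAbove l))) (k : ℤ)
    have hfC : ∀ k, f k ≤ C / (1 - δ) := fun k => by
      rw [le_div_iff₀' hδ1]
      exact hC _ _
    have hinc : ∀ h : ℕ → ℝ, (∀ k, 0 ≤ h k) → (∀ k, h k ≤ 1) →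
        ∑ k ∈ range (N + 1), f k * (h (k + 1) - h k) ≤ C / (1 - δ) := fun h h0 h1 =>
      sum_mul_increment_le (fun k => onesLaw_nonneg hδ _ _) hfC
        (onesLaw_antitone_after hδ _) h0 h1 N
    have hx : ∀ x, |∑ k ∈ range (N + 1), f k * (H x ((k + 1 : ℕ) : ℤ) - H x (k : ℤ))| ≤
        C / (1 - δ) := fun x => by
      refine abs_le'.2 ⟨hinc (fun k => H x k) (fun k => (hH01 x k).1) fun k => (hH01 x k).2, ?_⟩
      refine le_trans (le_of_eq ?_) (hinc (fun k => 1 - H x k)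
        (fun k => sub_nonneg.2 (hH01 x k).2) fun k => sub_le_self _ (hH01 x k).1)
      rw [← Finset.sum_neg_distrib]
      exact Finset.sum_congr rfl fun k _ => by ring
    rw [abs_mul, abs_of_pos hδ1, ← le_div_iff₀' hδ1]
    calc _ ≤ ∑ x : Fin 2, perturbW 2 δ (A i) x * (C / (1 - δ)) := by
          refine (Finset.abs_sum_le_sum_abs _ _).trans (Finset.sum_le_sum fun x _ => ?_)
          rw [abs_mul, abs_of_nonneg (perturbW_two_nonneg hδ _ _)]
          exact mul_le_mul_of_nonneg_left (hx x) (perturbW_two_nonneg hδ _ _)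
      _ = C / (1 - δ) := by
          rw [← Finset.sum_mul, Fin.sum_univ_two, perturbW_two_add, one_mul]
  have heq : ∀ l, l ≠ i.succAbove j → a l = b l := fun l hl => not_not.1 (mt (hmem l).1 hl)
  rcases Fin.eq_zero_or_eq_succ (a (i.succAbove j)) with h | ⟨x, h⟩ <;>
    rcases Fin.eq_zero_or_eq_succ (b (i.succAbove j)) with h' | ⟨y, h'⟩
  · exact absurd (h.trans h'.symm) hne
  · rw [abs_sub_comm]
    exact key b a (fun l hl => (heq l hl).symm) (by rw [h', Subsingleton.elim y 0]; rfl) h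
  · exact key a b heq (by rw [h, Subsingleton.elim x 0]; rfl) h'
  · exact absurd (by rw [h, h', Subsingleton.elim x y]) hne

lemma lam_le {δ : ℝ} (hδ : δ ∈ Set.Ioo (0 : ℝ) 1) {N : ℕ} {C : ℝ} (hC0 : 0 ≤ C)
    (hC : ∀ (a : Fin N → Fin 2) (z : ℤ), (1 - δ) * onesLaw δ a z ≤ C) :
    lam (N + 2) 2 δ ≤ C := by
  refine Real.sSup_le ?_ hC0
  rintro _ ⟨g, hg, ha, rfl⟩
  refine Real.sSup_le ?_ hC0
  rintro _ ⟨i, a, b, hab, hcard, rfl⟩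
  exact abs_perturbGame_sub_le_s2 hδ hC hg ha hab hcard

lemma le_lam {δ : ℝ} (hδ : δ ∈ Set.Ioo (0 : ℝ) 1) {N : ℕ} (a : Fin N → Fin 2) (z : ℕ)
    (hz : z ≤ N) : (1 - δ) * onesLaw δ a (z : ℤ) ≤ lam (N + 2) 2 δ := by
  have hδ1 : 0 < 1 - δ := sub_pos.2 hδ.2
  have hC : ∀ (a : Fin N → Fin 2) (z : ℤ), (1 - δ) * onesLaw δ a z ≤ 1 - δ := fun a z =>
    mul_le_of_le_one_right hδ1.le (onesLaw_le_one hδ a z)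
  set H : Fin 2 → ℤ → ℝ := fun _ k => if (z : ℤ) < k then 1 else 0 with hH
  set g : (Fin (N + 2) → Fin 2) → Fin (N + 2) → ℝ :=
    fun b i => H (b i) (ones b - (b i).val) with hg
  have hgame : IsGame (N + 2) 2 g := fun b i => by
    simp only [hg, hH]
    split_ifs <;> simp
  have hanon : IsAnonymous (N + 2) 2 g := fun b c i hi hc => by
    have h : ones b = ones c := by rw [← actCount_one, ← actCount_one, hc]
    simp only [hg, hi, h]
  set A : Fin (N + 2) → Fin 2 := Fin.cons 0 (Fin.cons 1 a)
  set B : Fin (N + 2) → Fin 2 := Fin.cons 0 (Fin.cons 0 a)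
  have hAB : ∀ l, l ≠ (0 : Fin (N + 2)).succAbove (0 : Fin (N + 1)) → A l = B l := by
    intro l hl
    induction l using Fin.cases with
    | zero => rfl
    | succ l =>
      induction l using Fin.cases with
      | zero => exact absurd rfl hl
      | succ l => rfl
  have hsub := perturbGame_sub_s2 δ (g := g) (i := 0) (H := H) (fun _ => rfl) 0 hAB rfl rfl
  have hval : (1 - δ) * onesLaw δ a (z : ℤ) =
      |perturbGame (N + 2) 2 δ g A 0 - perturbGame (N + 2) 2 δ g B 0| := by
    have hA : (fun l => A ((0 : Fin (N + 2)).succAbove ((0 : Fin (N + 1)).succAbove l))) = a := rfl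
    have hsum : ∀ x, ∑ k ∈ range (N + 1), onesLaw δ a (k : ℤ) *
        (H x ((k + 1 : ℕ) : ℤ) - H x (k : ℤ)) = onesLaw δ a (z : ℤ) := fun x => by
      rw [Finset.sum_eq_single z]
      · simp [hH]
      · intro k _ hk
        have : ((z : ℤ) < ((k + 1 : ℕ) : ℤ)) ↔ ((z : ℤ) < k) := by omega
        simp only [hH, this, sub_self, mul_zero]
      · intro h
        exact absurd (Finset.mem_range.2 (by omega)) h
    rw [hsub, hA]
    simp only [hsum]
    rw [← Finset.sum_mul, Fin.sum_univ_two, perturbW_two_add, one_mul,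
      abs_of_nonneg (mul_nonneg hδ1.le (onesLaw_nonneg hδ a z))]
  have hcard : (Finset.univ.filter fun j => A j ≠ B j).card = 1 := by
    refine Finset.card_eq_one.2 ⟨1, ?_⟩
    ext l
    simp only [Finset.mem_filter, Finset.mem_univ, true_and, Finset.mem_singleton]
    refine ⟨fun h => by_contra fun hl => h (hAB l hl), ?_⟩
    rintro rfl
    exact one_ne_zero
  have hlip : (1 - δ) * onesLaw δ a (z : ℤ) ≤ lipC (N + 2) 2 (perturbGame (N + 2) 2 δ g) := by
    refine le_csSup ⟨1 - δ, ?_⟩ ⟨0, A, B, rfl, hcard, hval⟩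
    rintro _ ⟨i, a, b, hab, hcard, rfl⟩
    exact abs_perturbGame_sub_le_s2 hδ hC hgame hanon hab hcard
  refine hlip.trans (le_csSup ⟨1 - δ, ?_⟩ ⟨g, hgame, hanon, rfl⟩)
  rintro _ ⟨g, hg, ha, rfl⟩
  refine Real.sSup_le ?_ hδ1.le
  rintro _ ⟨i, a, b, hab, hcard, rfl⟩
  exact abs_perturbGame_sub_le_s2 hδ hC hg ha hab hcard

lemma onesLaw_append (δ : ℝ) {M N : ℕ} (a : Fin M → Fin 2) (b : Fin N → Fin 2) (z : ℤ) :
    onesLaw δ (Fin.append a b) z =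
      ∑ k ∈ range (M + 1), onesLaw δ a (k : ℤ) * onesLaw δ b (z - k) := by
  rw [← sum_profW_mul δ a fun k => onesLaw δ b (z - k), onesLaw,
    ← (Fin.appendEquiv M N).sum_comp, Fintype.sum_prod_type]
  refine Finset.sum_congr rfl fun c _ => ?_
  rw [onesLaw, Finset.mul_sum]
  refine Finset.sum_congr rfl fun d _ => ?_
  have h1 : ones (Fin.append c d) = ones c + ones d := by simp [ones, Fin.sum_univ_add]
  have h2 : profW (M + N) 2 δ (Fin.append a b) (Fin.append c d) =
      profW M 2 δ a c * profW N 2 δ b d := by simp [profW, Fin.prod_univ_add]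
  simp only [Fin.appendEquiv, Equiv.coe_fn_mk, h1, h2, mul_ite, mul_zero, eq_sub_iff_add_eq']

lemma onesLaw_rev (δ : ℝ) {N : ℕ} (a : Fin N → Fin 2) (z : ℤ) :
    onesLaw δ (fun l => (a l).rev) (N - z) = onesLaw δ a z := by
  unfold onesLaw
  rw [← (Equiv.arrowCongr (Equiv.refl (Fin N)) (Fin.revPerm (n := 2))).sum_comp]
  refine Finset.sum_congr rfl fun c _ => ?_
  have h1 : ones (fun l => (c l).rev) = N - ones c := by
    have h : (N : ℤ) = ∑ _l : Fin N, 1 := by simp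
    rw [ones, ones, h, ← Finset.sum_sub_distrib]
    refine Finset.sum_congr rfl fun l _ => ?_
    generalize c l = x
    fin_cases x <;> simp
  have h2 : profW N 2 δ (fun l => (a l).rev) (fun l => (c l).rev) = profW N 2 δ a c := by
    simp [profW, perturbW]
  have h3 : (Equiv.arrowCongr (Equiv.refl (Fin N)) (Fin.revPerm (n := 2))) c =
      fun l => (c l).rev := rfl
  rw [h3, h1, h2]
  simp only [sub_right_inj]

lemma sum_onesLaw_sq (δ : ℝ) {N : ℕ} (a : Fin N → Fin 2) :
    onesLaw δ (Fin.append a fun l => (a l).rev) ((N : ℕ) : ℤ) =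
      ∑ k ∈ range (N + 1), onesLaw δ a (k : ℤ) ^ 2 := by
  rw [onesLaw_append]
  exact Finset.sum_congr rfl fun k _ => by rw [onesLaw_rev, sq]

lemma sum_onesLaw_sq_le_lam {δ : ℝ} (hδ : δ ∈ Set.Ioo (0 : ℝ) 1) {N : ℕ} (a : Fin N → Fin 2) :
    (1 - δ) * ∑ k ∈ range (N + 1), onesLaw δ a (k : ℤ) ^ 2 ≤ lam (N + N + 2) 2 δ := by
  rw [← sum_onesLaw_sq]
  exact le_lam hδ _ N (Nat.le_add_left N N)

lemma onesLaw_eq_zero (δ : ℝ) {N : ℕ} (a : Fin N → Fin 2) {z : ℤ} (hz : z < 0 ∨ N < z) :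
    onesLaw δ a z = 0 :=
  Finset.sum_eq_zero fun c _ => if_neg (by have := ones_nonneg c; have := ones_le c; omega)

lemma lam_nonneg {δ : ℝ} (hδ : δ ∈ Set.Ioo (0 : ℝ) 1) (N : ℕ) : 0 ≤ lam (N + 2) 2 δ :=
  (mul_nonneg (sub_pos.2 hδ.2).le (onesLaw_nonneg hδ _ _)).trans
    (le_lam hδ (fun _ => 0) 0 (Nat.zero_le N))

lemma mul_onesLaw_le_lam {δ : ℝ} (hδ : δ ∈ Set.Ioo (0 : ℝ) 1) {N : ℕ} (a : Fin N → Fin 2)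
    (z : ℤ) : (1 - δ) * onesLaw δ a z ≤ lam (N + 2) 2 δ := by
  by_cases hz : z < 0 ∨ N < z
  · rw [onesLaw_eq_zero δ a hz, mul_zero]
    exact lam_nonneg hδ N
  · push Not at hz
    lift z to ℕ using hz.1
    exact le_lam hδ a z (by exact_mod_cast hz.2)

lemma lam_succ_le {δ : ℝ} (hδ : δ ∈ Set.Ioo (0 : ℝ) 1) (N : ℕ) :
    lam (N + 3) 2 δ ≤ lam (N + 2) 2 δ := by
  refine lam_le hδ (lam_nonneg hδ N) fun a z => ?_
  have h0 := mul_le_mul_of_nonneg_left (mul_onesLaw_le_lam hδ (fun l => a l.succ) z)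
    (perturbW_two_nonneg hδ (a 0) 0)
  have h1 := mul_le_mul_of_nonneg_left (mul_onesLaw_le_lam hδ (fun l => a l.succ) (z - 1))
    (perturbW_two_nonneg hδ (a 0) 1)
  have h : lam (N + 2) 2 δ = perturbW 2 δ (a 0) 0 * lam (N + 2) 2 δ +
      perturbW 2 δ (a 0) 1 * lam (N + 2) 2 δ := by
    rw [← add_mul, perturbW_two_add, one_mul]
  rw [onesLaw_succ]
  linarith

lemma sum_onesLaw_sub_sq_le (δ : ℝ) {M N : ℕ} (b : Fin N → Fin 2) (z : ℤ) :
    ∑ k ∈ range (M + 1), onesLaw δ b (z - k) ^ 2 ≤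
      ∑ k ∈ range (N + 1), onesLaw δ b (k : ℤ) ^ 2 := by
  classical
  have h : ∑ k ∈ (range (M + 1)).filter (fun k : ℕ => 0 ≤ z - k ∧ z - k ≤ N),
      onesLaw δ b (z - k) ^ 2 = ∑ k ∈ range (M + 1), onesLaw δ b (z - k) ^ 2 := by
    refine Finset.sum_filter_of_ne fun k _ hk => ?_
    by_contra hcon
    exact hk (by rw [onesLaw_eq_zero δ b (by omega)]; simp)
  rw [← h]
  calc _ = ∑ k ∈ (range (M + 1)).filter (fun k : ℕ => 0 ≤ z - k ∧ z - k ≤ N),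
        onesLaw δ b ((z - k).toNat : ℤ) ^ 2 := by
        refine Finset.sum_congr rfl fun k hk => ?_
        rw [Int.toNat_of_nonneg (Finset.mem_filter.1 hk).2.1]
    _ = ∑ m ∈ ((range (M + 1)).filter (fun k : ℕ => 0 ≤ z - k ∧ z - k ≤ N)).image
          (fun k : ℕ => (z - k).toNat), onesLaw δ b (m : ℤ) ^ 2 := by
        rw [Finset.sum_image]
        intro k hk l hl hkl
        have hk' := (Finset.mem_filter.1 hk).2
        have hl' := (Finset.mem_filter.1 hl).2
        dsimp only at hkl
        omega
    _ ≤ _ := by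
        refine Finset.sum_le_sum_of_subset_of_nonneg ?_ fun _ _ _ => sq_nonneg _
        intro m hm
        obtain ⟨k, hk, rfl⟩ := Finset.mem_image.1 hm
        have hk' := (Finset.mem_filter.1 hk).2
        exact Finset.mem_range.2 (by omega)

lemma lam_odd_le {δ : ℝ} (hδ : δ ∈ Set.Ioo (0 : ℝ) 1) (n : ℕ) :
    lam (n + (n + 1) + 2) 2 δ ≤
      √(lam (n + n + 2) 2 δ * lam (n + 1 + (n + 1) + 2) 2 δ) := by
  refine lam_le hδ (Real.sqrt_nonneg _) fun a z => Real.le_sqrt_of_sq_le ?_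
  obtain ⟨⟨b, c⟩, rfl⟩ := (Fin.appendEquiv n (n + 1)).surjective a
  change ((1 - δ) * onesLaw δ (Fin.append b c) z) ^ 2 ≤ _
  have hδ1 : 0 < 1 - δ := sub_pos.2 hδ.2
  rw [onesLaw_append]
  calc _ = (1 - δ) ^ 2 *
        (∑ k ∈ range (n + 1), onesLaw δ b (k : ℤ) * onesLaw δ c (z - k)) ^ 2 := mul_pow _ _ _
    _ ≤ (1 - δ) ^ 2 * ((∑ k ∈ range (n + 1), onesLaw δ b (k : ℤ) ^ 2) *
          ∑ k ∈ range (n + 1 + 1), onesLaw δ c (k : ℤ) ^ 2) := by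
        gcongr
        refine (Finset.sum_mul_sq_le_sq_mul_sq _ _ _).trans ?_
        gcongr ?_ * ?_
        exact sum_onesLaw_sub_sq_le δ c z
    _ = ((1 - δ) * ∑ k ∈ range (n + 1), onesLaw δ b (k : ℤ) ^ 2) *
          ((1 - δ) * ∑ k ∈ range (n + 1 + 1), onesLaw δ c (k : ℤ) ^ 2) := by ring
    _ ≤ _ := by
        gcongr
        · exact lam_nonneg hδ _
        · exact sum_onesLaw_sq_le_lam hδ b
        · exact sum_onesLaw_sq_le_lam hδ c

/-- For `n ≥ 1` and `δ ∈ (0,1)`, writing `λ_m = lam m 2 δ`, one has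
`λ_{2n+2} ≤ λ_{2n+1} ≤ √(λ_{2n}·λ_{2n+2})`. -/
theorem lipschitz_constant_two_actions_odd (n : ℕ) (hn : 1 ≤ n)
    (δ : ℝ) (hδ : δ ∈ Set.Ioo (0 : ℝ) 1) :
    lam (2 * n + 2) 2 δ ≤ lam (2 * n + 1) 2 δ ∧
      lam (2 * n + 1) 2 δ ≤ Real.sqrt (lam (2 * n) 2 δ * lam (2 * n + 2) 2 δ) := by
  obtain ⟨m, rfl⟩ := Nat.exists_eq_add_of_le' hn
  have h0 : 2 * (m + 1) = m + m + 2 := by ring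
  have h1 : 2 * (m + 1) + 1 = m + (m + 1) + 2 := by ring
  have h2 : 2 * (m + 1) + 2 = m + 1 + (m + 1) + 2 := by ring
  have h3 : m + 1 + (m + 1) + 2 = m + (m + 1) + 3 := by ring
  rw [h2, h1, h0]
  exact ⟨h3 ▸ lam_succ_le hδ _, lam_odd_le hδ m⟩
end
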